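/- If f, g : (0,∞) → (0,∞) are non-increasing, then for any M > 0 and any function x : [0,M] → ℝ, ∫₀^M ∫₀^M f(s) g(r + |s − x(r)|) dr ds ≤ 2 ∫₀^{3M/2} F(u) g(u) du, where F(u) = ∫₀^u f(s) ds. -/

import Mathlib

open MeasureTheory

open scoped ENNReal Topology

/-- A bounded real function has a maximal measurable minorant: the function cannot exceed it by a
fixed amount on a measurable set of positive measure. -/
lemma exists_maximal_measurable_minorant {α : Type*} [MeasurableSpace α] (μ : Measure α)
    [IsFiniteMeasure μ] (y : α → ℝ) (M : ℝ) (hy0 : ∀ a, 0 ≤ y a) (hyM : ∀ a, y a ≤ M) :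
    ∃ z : α → ℝ, Measurable z ∧ (∀ a, z a ≤ y a) ∧
      ∀ ε > 0, ∀ A, MeasurableSet A → (∀ a ∈ A, z a + ε ≤ y a) → μ A = 0 := by
  obtain ⟨w, hwm, hwy, hw⟩ := exists_measurable_le_lintegral_eq μ fun a => ENNReal.ofReal (y a)
  have hwt (a) : w a ≠ ∞ := ((hwy a).trans_lt ENNReal.ofReal_lt_top).ne
  have hfin : ∫⁻ a, w a ∂μ ≠ ∞ := by
    rw [← hw]
    refine ((lintegral_mono fun a => ENNReal.ofReal_le_ofReal (hyM a)).trans_lt ?_).ne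
    rw [lintegral_const]
    exact ENNReal.mul_lt_top ENNReal.ofReal_lt_top (measure_lt_top μ _)
  refine ⟨fun a => (w a).toReal, hwm.ennreal_toReal, fun a => ?_, fun ε hε A hA hAy => ?_⟩
  · exact ENNReal.toReal_le_of_le_ofReal (hy0 a) (hwy a)
  · have hle : ∫⁻ a, w a ∂μ + ENNReal.ofReal ε * μ A ≤ ∫⁻ a, w a ∂μ := by
      calc _ = ∫⁻ a, (w a + A.indicator (fun _ => ENNReal.ofReal ε) a) ∂μ := by
            rw [lintegral_add_left hwm, lintegral_indicator_const hA]
        _ ≤ ∫⁻ a, ENNReal.ofReal (y a) ∂μ := by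
            refine lintegral_mono fun a => ?_
            by_cases ha : a ∈ A
            · simp only [Set.indicator_of_mem ha]
              rw [← ENNReal.ofReal_toReal (hwt a), ← ENNReal.ofReal_add (by positivity) hε.le]
              exact ENNReal.ofReal_le_ofReal (hAy a ha)
            · simpa [Set.indicator_of_notMem ha] using hwy a
        _ = _ := hw
    have h0 : ENNReal.ofReal ε * μ A = 0 := by
      have := ENNReal.le_sub_of_add_le_left hfin hle
      simpa using this
    simpa [hε.not_ge] using h0

/-- The lower integral of a decreasing function of the distance to an arbitrary bounded function is
controlled by replacing that function by a single measurable one, uniformly in the base point. -/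
lemma exists_measurable_lintegral_dist_le (μ : Measure ℝ) [IsFiniteMeasure μ] (g : ℝ → ℝ≥0∞)
    (hg : Antitone g) (y : ℝ → ℝ) (M : ℝ) (hy0 : ∀ a, 0 ≤ y a) (hyM : ∀ a, y a ≤ M) :
    ∃ z : ℝ → ℝ, Measurable z ∧ ∀ s, ∫⁻ r, g (r + |s - y r|) ∂μ ≤
      ∫⁻ r, Function.leftLim g (r + |s - z r|) ∂μ := by
  obtain ⟨z, hzm, hzy, hz⟩ := exists_maximal_measurable_minorant μ y M hy0 hyM
  refine ⟨z, hzm, fun s => ?_⟩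
  obtain ⟨m, hmm, hmle, hm⟩ := exists_measurable_le_lintegral_eq μ fun r => g (r + |s - y r|)
  rw [hm]
  have key (n : ℕ) : ∀ᵐ r ∂μ, m r ≤ g (r + |s - z r| - 1 / ((n : ℝ) + 1)) := by
    have hn : (0 : ℝ) < 1 / ((n : ℝ) + 1) := by positivity
    rw [ae_iff]
    refine hz _ hn _ ?_ fun r hr => ?_
    · refine (measurableSet_le hmm ?_).compl
      exact hg.measurable.comp (by fun_prop)
    · by_contra! hlt
      refine hr ((hmle r).trans (hg ?_))
      have h1 : |s - z r| ≤ |s - y r| + |y r - z r| := by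
        simpa using abs_add_le (s - y r) (y r - z r)
      rw [abs_of_nonneg (sub_nonneg.2 (hzy r))] at h1
      linarith
  refine lintegral_mono_ae ?_
  filter_upwards [ae_all_iff.2 key] with r hr
  suffices hlim : Filter.Tendsto (fun n : ℕ => r + |s - z r| - 1 / ((n : ℝ) + 1)) Filter.atTop
      (𝓝[<] (r + |s - z r|)) from ge_of_tendsto' ((hg.tendsto_leftLim _).comp hlim) hr
  refine tendsto_nhdsWithin_iff.2 ⟨?_, Filter.Eventually.of_forall fun n => ?_⟩
  · simpa using tendsto_const_nhds.sub (tendsto_one_div_add_atTop_nhds_zero_nat (𝕜 := ℝ))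
  · have hn : (0 : ℝ) < 1 / ((n : ℝ) + 1) := by positivity
    simp only [Set.mem_Iio]
    linarith

/-- Exchanging a set for one of larger measure on which the integrand is larger does not decrease
the integral. -/
lemma setLIntegral_le_of_exchange {α : Type*} [MeasurableSpace α] {μ : Measure α} {f : α → ℝ≥0∞}
    {E T : Set α} (hE : MeasurableSet E) (hT : MeasurableSet T) (hfin : μ T ≠ ∞) (hle : μ E ≤ μ T)
    (hf : ∀ a ∈ E \ T, ∀ b ∈ T \ E, f a ≤ f b) :
    ∫⁻ a in E, f a ∂μ ≤ ∫⁻ a in T, f a ∂μ := by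
  rw [← lintegral_inter_add_sdiff f E hT, ← lintegral_inter_add_sdiff f T hE, Set.inter_comm T E]
  refine add_le_add le_rfl ?_
  have hdiff : μ (E \ T) ≤ μ (T \ E) := by
    rw [← measure_inter_add_sdiff E hT, ← measure_inter_add_sdiff T hE, Set.inter_comm T E] at hle
    exact (ENNReal.add_le_add_iff_left (measure_ne_top_of_subset Set.inter_subset_right hfin)).1 hle
  calc ∫⁻ a in E \ T, f a ∂μ ≤ ∫⁻ _ in E \ T, (⨆ a ∈ E \ T, f a) ∂μ :=
        setLIntegral_mono' (hE.diff hT) fun a ha => le_iSup₂ (f := fun a _ => f a) a ha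
    _ = (⨆ a ∈ E \ T, f a) * μ (E \ T) := setLIntegral_const _ _
    _ ≤ (⨆ a ∈ E \ T, f a) * μ (T \ E) := by gcongr
    _ = ∫⁻ _ in T \ E, (⨆ a ∈ E \ T, f a) ∂μ := (setLIntegral_const _ _).symm
    _ ≤ ∫⁻ a in T \ E, f a ∂μ :=
        setLIntegral_mono' (hT.diff hE) fun b hb => iSup₂_le fun a ha => hf a ha b hb

lemma lintegral_Ioi_ite_ofReal_lt (c : ℝ≥0∞) :
    ∫⁻ t in Set.Ioi (0 : ℝ), (if ENNReal.ofReal t < c then 1 else 0) = c := by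
  have hm : MeasurableSet {t : ℝ | ENNReal.ofReal t < c} :=
    measurableSet_lt ENNReal.measurable_ofReal measurable_const
  have h : (fun t : ℝ => if ENNReal.ofReal t < c then (1 : ℝ≥0∞) else 0) =
      {t : ℝ | ENNReal.ofReal t < c}.indicator 1 := by
    ext t
    simp [Set.indicator_apply]
  rw [h, lintegral_indicator_one hm, Measure.restrict_apply hm]
  induction c with
  | top => simp
  | coe c =>
    have : {t : ℝ | ENNReal.ofReal t < c} ∩ Set.Ioi 0 = Set.Ioo 0 (c : ℝ) := by
      ext t
      simp only [Set.mem_inter_iff, Set.mem_ofPred_eq, Set.mem_Ioi, Set.mem_Ioo]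
      rw [and_comm]
      refine and_congr_right fun ht => ?_
      rw [ENNReal.ofReal_lt_iff_lt_toReal ht.le ENNReal.coe_ne_top, ENNReal.coe_toReal]
    rw [this]
    simp

lemma volume_superlevel_abs_sub_le (h : ℝ → ℝ≥0∞) (hh : Antitone h) (M y : ℝ) (t : ℝ≥0∞) :
    volume (Set.Ioc 0 M ∩ {s | t < h |s - y|}) ≤ volume (Set.Ioc 0 M ∩ {s | t < h (s / 2)}) := by
  refine le_of_forall_gt_imp_ge_of_dense fun c hc => ?_
  induction c with
  | top => exact le_top
  | coe p =>
    rcases lt_or_ge M p with hp | hp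
    · calc _ ≤ volume (Set.Ioc 0 M) := measure_mono Set.inter_subset_left
        _ ≤ ENNReal.ofReal p := by
          rw [Real.volume_Ioc]
          exact ENNReal.ofReal_le_ofReal (by linarith)
        _ = p := by simp
    · have hpt : ¬ t < h (p / 2) := fun hpt => by
        refine hc.not_ge ?_
        calc (p : ℝ≥0∞) = volume (Set.Ioc 0 (p : ℝ)) := by simp
          _ ≤ volume (Set.Ioc 0 M ∩ {s | t < h (s / 2)}) := measure_mono fun s hs =>
            ⟨⟨hs.1, hs.2.trans hp⟩, hpt.trans_le (hh (by linarith [hs.2]))⟩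
      calc _ ≤ volume (Set.Icc (y - p / 2) (y + p / 2)) := by
            refine measure_mono fun s hs => ?_
            have hlt : |s - y| < p / 2 := by
              by_contra! hge
              exact hpt (lt_of_lt_of_le hs.2 (hh hge))
            rw [abs_lt] at hlt
            constructor <;> linarith
        _ = p := by
            rw [Real.volume_Icc]
            ring_nf
            simp

lemma lintegral_mul_comp_abs_sub_le (f h : ℝ → ℝ≥0∞) (hf : Antitone f) (hh : Antitone h)
    (M y : ℝ) :
    ∫⁻ s in Set.Ioc 0 M, f s * h |s - y| ≤ ∫⁻ s in Set.Ioc 0 M, f s * h (s / 2) := by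
  have hhm := hh.measurable
  have hfm := hf.measurable
  have layer (d : ℝ → ℝ) (hd : Measurable d) : ∫⁻ s in Set.Ioc 0 M, f s * h (d s) =
      ∫⁻ t in Set.Ioi (0 : ℝ), ∫⁻ s in Set.Ioc 0 M ∩ {s | ENNReal.ofReal t < h (d s)}, f s := by
    have hms : MeasurableSet {p : ℝ × ℝ | ENNReal.ofReal p.2 < h (d p.1)} :=
      measurableSet_lt (by fun_prop) (by fun_prop)
    calc _ = ∫⁻ s in Set.Ioc 0 M, ∫⁻ t in Set.Ioi (0 : ℝ),
          f s * (if ENNReal.ofReal t < h (d s) then 1 else 0) := by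
          refine lintegral_congr fun s => ?_
          rw [lintegral_const_mul, lintegral_Ioi_ite_ofReal_lt]
          exact Measurable.ite (measurableSet_lt (by fun_prop) (by fun_prop)) (by fun_prop)
            (by fun_prop)
      _ = ∫⁻ t in Set.Ioi (0 : ℝ), ∫⁻ s in Set.Ioc 0 M,
          f s * (if ENNReal.ofReal t < h (d s) then 1 else 0) := by
          refine lintegral_lintegral_swap (Measurable.aemeasurable ?_)
          exact (hfm.comp measurable_fst).mul (Measurable.ite hms (by fun_prop) (by fun_prop))
      _ = _ := by
          refine lintegral_congr fun t => ?_
          have hmt : MeasurableSet {s | ENNReal.ofReal t < h (d s)} :=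
            measurableSet_lt (by fun_prop) (by fun_prop)
          rw [Set.inter_comm, ← Measure.restrict_restrict hmt, ← lintegral_indicator hmt]
          refine lintegral_congr fun s => ?_
          simp [Set.indicator_apply]
  rw [layer (fun s => |s - y|) (by fun_prop), layer (fun s => s / 2) (by fun_prop)]
  refine lintegral_mono fun t => setLIntegral_le_of_exchange
    (measurableSet_Ioc.inter (measurableSet_lt (by fun_prop) (by fun_prop)))
    (measurableSet_Ioc.inter (measurableSet_lt (by fun_prop) (by fun_prop)))
    (measure_ne_top_of_subset Set.inter_subset_left (by simp))
    (volume_superlevel_abs_sub_le h hh M y _) fun a ha b hb => hf ?_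
  by_contra! hab
  exact ha.2 ⟨ha.1.1, lt_of_lt_of_le hb.1.2 (hh (by linarith))⟩

lemma setLIntegral_Ioc_two_mul_le (f : ℝ → ℝ≥0∞) (hf : Antitone f) (u : ℝ) (hu : 0 < u) :
    ∫⁻ s in Set.Ioc 0 (2 * u), f s ≤ 2 * ∫⁻ s in Set.Ioc 0 u, f s := by
  rw [← Set.Ioc_union_Ioc_eq_Ioc hu.le (by linarith : u ≤ 2 * u), two_mul (∫⁻ s in _, f s)]
  refine (lintegral_union_le _ _ _).trans ?_
  refine add_le_add le_rfl ?_
  refine setLIntegral_le_of_exchange measurableSet_Ioc measurableSet_Ioc (by simp) ?_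
    fun a ha b hb => hf (hb.1.2.trans ha.1.1.le)
  simp only [Real.volume_Ioc]
  exact ENNReal.ofReal_le_ofReal (by linarith)

lemma lintegral_lintegral_add_half_le (f g : ℝ → ℝ≥0∞) (hf : Antitone f) (hg : Antitone g)
    (M : ℝ) :
    ∫⁻ s in Set.Ioc 0 M, ∫⁻ r in Set.Ioc 0 M, f s * g (r + s / 2) ≤
      2 * ∫⁻ u in Set.Ioc 0 (3 * M / 2), (∫⁻ s in Set.Ioc 0 u, f s) * g u := by
  have hfm := hf.measurable
  have hgm := hg.measurable
  have hshift : ∀ s ∈ Set.Ioc 0 M, ∫⁻ r in Set.Ioc 0 M, f s * g (r + s / 2) ≤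
      ∫⁻ u in Set.Ioc 0 (3 * M / 2), if s ≤ 2 * u then f s * g u else 0 := by
    intro s hs
    rw [← lintegral_indicator measurableSet_Ioc, ← lintegral_indicator measurableSet_Ioc,
      ← lintegral_add_right_eq_self (Set.indicator (Set.Ioc 0 (3 * M / 2)) _) (s / 2)]
    refine lintegral_mono fun r =>
      Set.indicator_apply_le' (fun hr => ?_) fun _ => zero_le
    have hmem : r + s / 2 ∈ Set.Ioc 0 (3 * M / 2) := by
      constructor <;> linarith [hr.1, hr.2, hs.1, hs.2]
    rw [Set.indicator_of_mem hmem, if_pos (by linarith [hr.1])]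
  calc _ ≤ ∫⁻ s in Set.Ioc 0 M, ∫⁻ u in Set.Ioc 0 (3 * M / 2),
        if s ≤ 2 * u then f s * g u else 0 := setLIntegral_mono' measurableSet_Ioc hshift
    _ = ∫⁻ u in Set.Ioc 0 (3 * M / 2), ∫⁻ s in Set.Ioc 0 M,
        if s ≤ 2 * u then f s * g u else 0 := by
        refine lintegral_lintegral_swap (Measurable.aemeasurable ?_)
        exact Measurable.ite (measurableSet_le (by fun_prop) (by fun_prop)) (by fun_prop)
          (by fun_prop)
    _ ≤ ∫⁻ u in Set.Ioc 0 (3 * M / 2), 2 * ((∫⁻ s in Set.Ioc 0 u, f s) * g u) := by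
        refine setLIntegral_mono' measurableSet_Ioc fun u hu => ?_
        calc _ ≤ ∫⁻ s in Set.Ioc 0 (2 * u), f s * g u := by
              rw [← lintegral_indicator measurableSet_Ioc, ← lintegral_indicator measurableSet_Ioc]
              refine lintegral_mono fun s => Set.indicator_apply_le fun hs => ?_
              split_ifs with hsu
              · rw [Set.indicator_of_mem (show s ∈ Set.Ioc 0 (2 * u) from ⟨hs.1, hsu⟩)]
              · exact zero_le
          _ = (∫⁻ s in Set.Ioc 0 (2 * u), f s) * g u := lintegral_mul_const _ hfm
          _ ≤ (2 * ∫⁻ s in Set.Ioc 0 u, f s) * g u := by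
              gcongr
              exact setLIntegral_Ioc_two_mul_le f hf u hu.1
          _ = _ := mul_assoc _ _ _
    _ = _ := lintegral_const_mul' _ _ (by simp)

/-- The rearrangement inequality for extended nonnegative antitone functions on the line. -/
lemma lintegral_lintegral_mul_comp_dist_le (f g : ℝ → ℝ≥0∞) (hf : Antitone f) (hg : Antitone g)
    (hfin : ∀ s > 0, f s ≠ ∞) (M : ℝ) (hM : 0 < M) (x : ℝ → ℝ) :
    ∫⁻ s in Set.Ioc 0 M, ∫⁻ r in Set.Ioc 0 M, f s * g (r + |s - x r|) ≤
      2 * ∫⁻ u in Set.Ioc 0 (3 * M / 2), (∫⁻ s in Set.Ioc 0 u, f s) * g u := by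
  obtain ⟨z, hzm, hz⟩ := exists_measurable_lintegral_dist_le (volume.restrict (Set.Ioc 0 M)) g hg
    (fun r => max 0 (min (x r) M)) M (fun r => le_max_left _ _)
    (fun r => max_le hM.le (min_le_right _ _))
  have hclamp : ∀ s ∈ Set.Ioc 0 M, ∀ r, |s - max 0 (min (x r) M)| ≤ |s - x r| := by
    intro s hs r
    have h := abs_max_sub_max_le_abs (min s M) (min (x r) M) 0
    rw [min_eq_left hs.2, max_eq_left hs.1.le, max_comm] at h
    refine h.trans ?_
    have h' := abs_min_sub_min_le_max s M (x r) M
    rw [min_eq_left hs.2] at h'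
    simpa using h'
  have hL : Antitone (Function.leftLim g) := hg.leftLim
  have hfm := hf.measurable
  have hLm := hL.measurable
  have hae : Function.leftLim g =ᵐ[volume] g := by
    filter_upwards [hg.countable_not_continuousAt.ae_notMem volume] with u hu
    exact (not_not.1 hu).continuousWithinAt.leftLim_eq
  calc _ ≤ ∫⁻ s in Set.Ioc 0 M, ∫⁻ r in Set.Ioc 0 M, f s * Function.leftLim g (r + |s - z r|) := by
        refine setLIntegral_mono' measurableSet_Ioc fun s hs => ?_
        rw [lintegral_const_mul' _ _ (hfin s hs.1), lintegral_const_mul' _ _ (hfin s hs.1)]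
        refine mul_le_mul' le_rfl (le_trans (lintegral_mono fun r => hg ?_) (hz s))
        exact add_le_add le_rfl (hclamp s hs r)
    _ = ∫⁻ r in Set.Ioc 0 M, ∫⁻ s in Set.Ioc 0 M, f s * Function.leftLim g (r + |s - z r|) := by
        refine lintegral_lintegral_swap (Measurable.aemeasurable ?_)
        simp only [Function.uncurry_def]
        fun_prop
    _ ≤ ∫⁻ r in Set.Ioc 0 M, ∫⁻ s in Set.Ioc 0 M, f s * Function.leftLim g (r + s / 2) :=
        lintegral_mono fun r => lintegral_mul_comp_abs_sub_le f (fun d => Function.leftLim g (r + d))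
          hf (fun a b hab => hL (by linarith)) M (z r)
    _ = ∫⁻ s in Set.Ioc 0 M, ∫⁻ r in Set.Ioc 0 M, f s * Function.leftLim g (r + s / 2) := by
        refine lintegral_lintegral_swap (Measurable.aemeasurable ?_)
        simp only [Function.uncurry_def]
        fun_prop
    _ ≤ 2 * ∫⁻ u in Set.Ioc 0 (3 * M / 2), (∫⁻ s in Set.Ioc 0 u, f s) * Function.leftLim g u :=
        lintegral_lintegral_add_half_le f _ hf hL M
    _ = _ := by
        congr 1
        refine lintegral_congr_ae (ae_restrict_of_ae ?_)
        filter_upwards [hae] with u hu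
        rw [hu]

lemma antitone_ite_top_ofReal (f : ℝ → ℝ) (hf : ∀ s t : ℝ, 0 < s → s ≤ t → f t ≤ f s) :
    Antitone fun s => if s ≤ 0 then ∞ else ENNReal.ofReal (f s) := by
  intro s t hst
  dsimp only
  split_ifs with ht hs hs
  · exact le_rfl
  · exact absurd (hst.trans ht) hs
  · exact le_top
  · exact ENNReal.ofReal_le_ofReal (hf s t (not_le.1 hs) hst)

/-- Rearrangement-type inequality for double integrals of products of
non-increasing functions. -/
theorem double_integral_rearrangement
    (f g : ℝ → ℝ) (M : ℝ) (hM : 0 < M) (x : ℝ → ℝ)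
    (hfpos : ∀ s > 0, 0 < f s)
    (hgpos : ∀ s > 0, 0 < g s)
    (hfmono : ∀ s t : ℝ, 0 < s → s ≤ t → f t ≤ f s)
    (hgmono : ∀ s t : ℝ, 0 < s → s ≤ t → g t ≤ g s) :
    (∫⁻ s in Set.Ioc (0:ℝ) M, ∫⁻ r in Set.Ioc (0:ℝ) M,
        ENNReal.ofReal (f s) * ENNReal.ofReal (g (r + |s - x r|)))
    ≤ 2 * ∫⁻ u in Set.Ioc (0:ℝ) (3 * M / 2),
        (∫⁻ s in Set.Ioc (0:ℝ) u, ENNReal.ofReal (f s)) * ENNReal.ofReal (g u) := by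
  have key := lintegral_lintegral_mul_comp_dist_le _ _ (antitone_ite_top_ofReal f hfmono)
    (antitone_ite_top_ofReal g hgmono) (fun s hs => by simp [not_le.2 hs]) M hM x
  have hF (u : ℝ) : ∫⁻ s in Set.Ioc 0 u, (if s ≤ 0 then ∞ else ENNReal.ofReal (f s)) =
      ∫⁻ s in Set.Ioc 0 u, ENNReal.ofReal (f s) :=
    setLIntegral_congr_fun measurableSet_Ioc fun s hs => if_neg (not_le.2 hs.1)
  simp only [hF] at key
  refine le_trans (le_of_eq ?_) (key.trans (le_of_eq ?_))
  · refine setLIntegral_congr_fun measurableSet_Ioc fun s hs =>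
      setLIntegral_congr_fun measurableSet_Ioc fun r hr => ?_
    have hpos : 0 < r + |s - x r| := add_pos_of_pos_of_nonneg hr.1 (abs_nonneg _)
    simp only [if_neg (not_le.2 hs.1), if_neg (not_le.2 hpos)]
  · congr 1
    refine setLIntegral_congr_fun measurableSet_Ioc fun u hu => ?_
    simp only [if_neg (not_le.2 hu.1)]
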